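/- Let n ≥ 1. There exists a unique group homomorphism ρ from the braid group B_{n+1} to the automorphism group of the free group F_{n+1} such that for each 1 ≤ i ≤ n: ρ(s_i)(x_i) = x_i x_{i+1} x_i^{−1}, ρ(s_i)(x_{i+1}) = x_i, and ρ(s_i)(x_j) = x_j for all j ∉ {i, i+1}. Moreover, ρ is injective; that is, this action of the braid group on the free group is faithful. -/

import Mathlib

/-- The braid relations on `n` generators: `sᵢ sⱼ = sⱼ sᵢ` for `|i - j| ≥ 2` and
`sᵢ sⱼ sᵢ = sⱼ sᵢ sⱼ` for `|i - j| = 1`. -/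
def braidRels (n : ℕ) : Set (FreeGroup (Fin n)) :=
  {r | ∃ i j : Fin n, (i : ℕ) + 2 ≤ (j : ℕ) ∧
      r = FreeGroup.of i * FreeGroup.of j * (FreeGroup.of j * FreeGroup.of i)⁻¹} ∪
  {r | ∃ i j : Fin n, (i : ℕ) + 1 = (j : ℕ) ∧
      r = FreeGroup.of i * FreeGroup.of j * FreeGroup.of i *
          (FreeGroup.of j * FreeGroup.of i * FreeGroup.of j)⁻¹}

/-- The braid group `B_{n+1}` on `n + 1` strands, presented with the `n` generators
`s_1, …, s_n` and the braid relations. -/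
def BraidGroup (n : ℕ) : Type := PresentedGroup (braidRels n)

noncomputable instance (n : ℕ) : Group (BraidGroup n) := by
  unfold BraidGroup; infer_instance

/-- The generator `sᵢ` of the braid group. -/
def braidGen (n : ℕ) (i : Fin n) : BraidGroup n := PresentedGroup.of i

/-- The defining formulas of the Artin action of the braid group `B_{n+1}` on the free
group `F_{n+1}`: `sᵢ ↦ (xᵢ ↦ xᵢ x_{i+1} xᵢ⁻¹, x_{i+1} ↦ xᵢ, xⱼ ↦ xⱼ (j ∉ {i, i+1}))`. -/
def IsArtinAction (n : ℕ) (ρ : BraidGroup n →* MulAut (FreeGroup (Fin (n + 1)))) : Prop :=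
  ∀ i : Fin n,
    (ρ (braidGen n i)) (FreeGroup.of i.castSucc) =
      FreeGroup.of i.castSucc * FreeGroup.of i.succ * (FreeGroup.of i.castSucc)⁻¹ ∧
    (ρ (braidGen n i)) (FreeGroup.of i.succ) = FreeGroup.of i.castSucc ∧
    ∀ j : Fin (n + 1), j ≠ i.castSucc → j ≠ i.succ →
      (ρ (braidGen n i)) (FreeGroup.of j) = FreeGroup.of j

/-- A family of elements whose first `n` members satisfy the braid relations. -/
structure IsBraidFamily {G : Type*} [Group G] (n : ℕ) (t : ℕ → G) : Prop where
  comm : ∀ i j, i + 2 ≤ j → j < n → t i * t j = t j * t i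
  braid : ∀ i, i + 1 < n → t i * t (i + 1) * t i = t (i + 1) * t i * t (i + 1)

/-- The product `t (j + d - 1) * ⋯ * t (j + 1) * t j`. -/
def descProd {G : Type*} [Group G] (t : ℕ → G) : ℕ → ℕ → G
  | _, 0 => 1
  | j, d + 1 => descProd t (j + 1) d * t j

/-- The product `t (m - 1) * ⋯ * t j`, moving the strand at position `j` to position `m`. -/
def sweep {G : Type*} [Group G] (t : ℕ → G) (m j : ℕ) : G := descProd t j (m - j)

/-- The strand at position `m` going once around the strand at position `i`. -/
def loop {G : Type*} [Group G] (t : ℕ → G) (m i : ℕ) : G :=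
  sweep t m (i + 1) * (t i * t i) * (sweep t m (i + 1))⁻¹

/-- The subgroup of braids on the strands `0, …, m`. -/
def initialSubgroup {G : Type*} [Group G] (t : ℕ → G) (m : ℕ) : Subgroup G :=
  Subgroup.closure (t '' Set.Iio m)

/-- The subgroup generated by the loops of the strand `m` around the strands `0, …, m - 1`. -/
def loopSubgroup {G : Type*} [Group G] (t : ℕ → G) (m : ℕ) : Subgroup G :=
  Subgroup.closure (loop t m '' Set.Iio m)

section Combing

variable {G : Type*} [Group G] {n : ℕ} {t : ℕ → G}

theorem sweep_self (t : ℕ → G) (m : ℕ) : sweep t m m = 1 := by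
  simp [sweep, descProd]

theorem sweep_of_lt (t : ℕ → G) {m j : ℕ} (h : j < m) :
    sweep t m j = sweep t m (j + 1) * t j := by
  obtain ⟨d, rfl⟩ := Nat.exists_eq_add_of_lt h
  have h1 : j + d + 1 - j = d + 1 := by omega
  have h2 : j + d + 1 - (j + 1) = d := by omega
  simp [sweep, h1, h2, descProd]

theorem sweep_induction {m : ℕ} {P : ℕ → Prop} (self : P m)
    (step : ∀ j < m, P (j + 1) → P j) : ∀ j ≤ m, P j := fun _ hj =>
  Nat.decreasingInduction (motive := fun k _ => P k) (fun k hk h => step k hk h) self hj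

theorem IsBraidFamily.sweep_comm (ht : IsBraidFamily n t) {m : ℕ} (hm : m ≤ n) {i : ℕ} :
    ∀ j ≤ m, i + 2 ≤ j → t i * sweep t m j = sweep t m j * t i := by
  refine sweep_induction ?_ ?_
  · simp [sweep_self]
  · intro j hj ih hij
    rw [sweep_of_lt t hj, ← mul_assoc, ih (by omega), mul_assoc, ht.comm i j hij (by omega),
      mul_assoc]

theorem IsBraidFamily.sweep_shift (ht : IsBraidFamily n t) {m : ℕ} (hm : m ≤ n) {i : ℕ}
    (hi : i + 1 < m) :
    ∀ j ≤ m, j ≤ i → sweep t m j * t (i + 1) = t i * sweep t m j := by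
  refine sweep_induction (by omega) ?_
  intro j hj ih hij
  rcases hij.eq_or_lt with rfl | hij
  · rw [sweep_of_lt t hj, sweep_of_lt t hi, mul_assoc, mul_assoc, ← mul_assoc (t (j + 1)),
      ← ht.braid j (by omega), ← mul_assoc (t j), ← mul_assoc, ← mul_assoc,
      ← ht.sweep_comm hm (j + 1 + 1) (by omega) (by omega)]
    simp only [mul_assoc]
  · rw [sweep_of_lt t hj, mul_assoc, ht.comm j (i + 1) (by omega) (by omega), ← mul_assoc,
      ih (by omega), mul_assoc]

theorem IsBraidFamily.loop_conj_of_lt (ht : IsBraidFamily n t) {m : ℕ} (hm : m ≤ n) {i j : ℕ}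
    (hij : i + 1 < j) (hj : j < m) : t i * loop t m j * (t i)⁻¹ = loop t m j := by
  rw [mul_inv_eq_iff_eq_mul]
  have h1 : Commute (t i) (sweep t m (j + 1)) := ht.sweep_comm hm _ hj (by omega)
  have h2 : Commute (t i) (t j) := ht.comm i j (by omega) (by omega)
  exact ((h1.mul_right (h2.mul_right h2)).mul_right h1.inv_right).eq

theorem IsBraidFamily.loop_conj_of_gt (ht : IsBraidFamily n t) {m : ℕ} (hm : m ≤ n) {i j : ℕ}
    (hji : j < i) (hi : i + 1 < m) : t i * loop t m j * (t i)⁻¹ = loop t m j := by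
  have h1 := ht.sweep_shift hm hi (j + 1) (by omega) (by omega)
  have h2 : Commute (t (i + 1)) (t j) := (ht.comm j (i + 1) (by omega) (by omega)).symm
  have h3 := (h2.mul_right h2).eq
  rw [mul_inv_eq_iff_eq_mul]
  rw [← mul_inv_eq_iff_eq_mul] at h1
  rw [← h1, loop]
  calc _ = sweep t m (j + 1) * (t (i + 1) * (t j * t j)) * (sweep t m (j + 1))⁻¹ := by group
    _ = _ := by rw [h3]; group

theorem IsBraidFamily.loop_conj_self (ht : IsBraidFamily n t) {m : ℕ} (hm : m ≤ n) {i : ℕ}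
    (hi : i + 1 < m) : t i * loop t m i * (t i)⁻¹ = loop t m (i + 1) := by
  have h1 := ht.sweep_comm hm (i := i) (i + 2) (by omega) (by omega)
  have h2 := ht.braid i (by omega)
  have h3 : t i * t (i + 1) * t i * (t i * t (i + 1))⁻¹ = t (i + 1) := by
    rw [h2]; group
  have h4 : t i * sweep t m (i + 2) * (t i)⁻¹ = sweep t m (i + 2) := by
    rw [h1]; group
  rw [loop, loop, sweep_of_lt t hi]
  calc _ = (t i * sweep t m (i + 2) * (t i)⁻¹) * ((t i * t (i + 1) * t i * (t i * t (i + 1))⁻¹) *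
        (t i * t (i + 1) * t i * (t i * t (i + 1))⁻¹)) *
        (t i * sweep t m (i + 2) * (t i)⁻¹)⁻¹ := by group
    _ = _ := by rw [h3, h4]

theorem IsBraidFamily.loop_conj_succ (ht : IsBraidFamily n t) {m : ℕ} (hm : m ≤ n) {i : ℕ}
    (hi : i + 1 < m) : t i * loop t m (i + 1) * (t i)⁻¹ =
      (loop t m (i + 1))⁻¹ * loop t m i * loop t m (i + 1) := by
  have h1 := ht.sweep_comm hm (i := i) (i + 2) (by omega) (by omega)
  have h2 := ht.braid i (by omega)
  have h3 : t i * t (i + 1) * (t i)⁻¹ = (t (i + 1))⁻¹ * t i * t (i + 1) := by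
    rw [mul_inv_eq_iff_eq_mul, mul_assoc, mul_assoc, ← mul_assoc (t i), h2]; group
  rw [loop, loop, sweep_of_lt t hi]
  calc
    _ = (t i * sweep t m (i + 2)) * (t (i + 1) * t (i + 1)) * (t i * sweep t m (i + 2))⁻¹ := by
      group
    _ = sweep t m (i + 2) * ((t i * t (i + 1) * (t i)⁻¹) * (t i * t (i + 1) * (t i)⁻¹)) *
        (sweep t m (i + 2))⁻¹ := by rw [h1]; group
    _ = _ := by rw [h3]; group

theorem loop_mem (t : ℕ → G) {m i : ℕ} (hi : i < m) : loop t m i ∈ loopSubgroup t m :=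
  Subgroup.subset_closure ⟨i, hi, rfl⟩

theorem gen_mem (t : ℕ → G) {m i : ℕ} (hi : i < m) : t i ∈ initialSubgroup t m :=
  Subgroup.subset_closure ⟨i, hi, rfl⟩

theorem IsBraidFamily.conj_mem (ht : IsBraidFamily n t) {m : ℕ} (hm : m ≤ n) {i : ℕ}
    (hi : i + 1 < m) {a : G} (ha : a ∈ loopSubgroup t m) :
    t i * a * (t i)⁻¹ ∈ loopSubgroup t m := by
  suffices h : loopSubgroup t m ≤ (loopSubgroup t m).comap (MulAut.conj (t i)).toMonoidHom from h ha
  refine (Subgroup.closure_le _).2 ?_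
  rintro _ ⟨j, hj, rfl⟩
  have hj : j < m := hj
  change t i * loop t m j * (t i)⁻¹ ∈ loopSubgroup t m
  rcases lt_trichotomy j i with h | rfl | h
  · rw [ht.loop_conj_of_gt hm h hi]; exact loop_mem t hj
  · rw [ht.loop_conj_self hm hi]; exact loop_mem t hi
  · rcases (Nat.succ_le_of_lt h).eq_or_lt with rfl | h
    · rw [Nat.succ_eq_add_one, ht.loop_conj_succ hm hi]
      exact mul_mem (mul_mem (inv_mem (loop_mem t hi)) (loop_mem t (by omega))) (loop_mem t hi)
    · rw [ht.loop_conj_of_lt hm h hj]; exact loop_mem t hj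

theorem IsBraidFamily.conj_inv_mem (ht : IsBraidFamily n t) {m : ℕ} (hm : m ≤ n) {i : ℕ}
    (hi : i + 1 < m) {a : G} (ha : a ∈ loopSubgroup t m) :
    (t i)⁻¹ * a * t i ∈ loopSubgroup t m := by
  suffices h : loopSubgroup t m ≤
      (loopSubgroup t m).map (MulAut.conj (t i)).toMonoidHom by
    obtain ⟨b, hb, rfl⟩ := h ha
    simpa [mul_assoc] using hb
  refine (Subgroup.closure_le _).2 ?_
  rintro _ ⟨j, hj, rfl⟩
  have hj : j < m := hj
  rcases lt_trichotomy j i with h | rfl | h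
  · exact ⟨_, loop_mem t hj, ht.loop_conj_of_gt hm h hi⟩
  · refine ⟨loop t m j * loop t m (j + 1) * (loop t m j)⁻¹,
      mul_mem (mul_mem (loop_mem t hj) (loop_mem t hi)) (inv_mem (loop_mem t hj)), ?_⟩
    rw [map_mul, map_mul, map_inv]
    change t j * loop t m j * (t j)⁻¹ * (t j * loop t m (j + 1) * (t j)⁻¹) *
      (t j * loop t m j * (t j)⁻¹)⁻¹ = _
    rw [ht.loop_conj_self hm hi, ht.loop_conj_succ hm hi]
    group
  · rcases (Nat.succ_le_of_lt h).eq_or_lt with rfl | h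
    · exact ⟨_, loop_mem t (i := i) (by omega), ht.loop_conj_self hm hi⟩
    · exact ⟨_, loop_mem t hj, ht.loop_conj_of_lt hm h hj⟩

theorem IsBraidFamily.initialSubgroup_le_normalizer (ht : IsBraidFamily n t) {m : ℕ}
    (hm : m + 1 ≤ n) :
    initialSubgroup t m ≤ Subgroup.normalizer (loopSubgroup t (m + 1) : Set G) := by
  refine (Subgroup.closure_le _).2 ?_
  rintro _ ⟨i, hi, rfl⟩
  have hi : i + 1 < m + 1 := Nat.succ_lt_succ hi
  refine Subgroup.mem_normalizer_iff.2 fun a => ⟨fun ha => ht.conj_mem hm hi ha, fun ha => ?_⟩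
  have := ht.conj_inv_mem hm hi ha
  simpa [mul_assoc] using this

theorem IsBraidFamily.sweep_mul_mem (ht : IsBraidFamily n t) {m : ℕ} (hm : m + 1 ≤ n) {i j : ℕ}
    (hi : i ≤ m) (hj : j ≤ m + 1) :
    sweep t (m + 1) j * t i * (sweep t (m + 1) (Equiv.swap i (i + 1) j))⁻¹ ∈
      loopSubgroup t (m + 1) ⊔ initialSubgroup t m := by
  rcases lt_trichotomy j i with h | rfl | h
  · rw [Equiv.swap_apply_of_ne_of_ne (by omega) (by omega)]
    obtain ⟨i, rfl⟩ : ∃ k, i = k + 1 := ⟨i - 1, by omega⟩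
    rw [ht.sweep_shift hm (by omega) j (by omega) (by omega)]
    simpa using Subgroup.mem_sup_right (gen_mem t (by omega))
  · rw [Equiv.swap_apply_left, sweep_of_lt t (by omega : j < m + 1)]
    convert Subgroup.mem_sup_left (loop_mem t (by omega : j < m + 1)) using 1
    rw [loop]; group
  · rcases (Nat.succ_le_of_lt h).eq_or_lt with rfl | h
    · rw [Nat.succ_eq_add_one, Equiv.swap_apply_right, sweep_of_lt t (by omega : i < m + 1)]
      simp [one_mem]
    · rw [Equiv.swap_apply_of_ne_of_ne (by omega) (by omega)]
      rw [← ht.sweep_comm hm j hj (by omega)]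
      simpa using Subgroup.mem_sup_right (gen_mem t (by omega))

theorem IsBraidFamily.exists_combing (ht : IsBraidFamily n t) {m : ℕ} (hm : m + 1 ≤ n) {g : G}
    (hg : g ∈ initialSubgroup t (m + 1)) :
    ∃ a ∈ loopSubgroup t (m + 1), ∃ h ∈ initialSubgroup t m, ∃ j ≤ m + 1,
      g = a * h * sweep t (m + 1) j := by
  set D := loopSubgroup t (m + 1) ⊔ initialSubgroup t m with hD
  have swap_le : ∀ {i j : ℕ}, i ≤ m → j ≤ m + 1 → Equiv.swap i (i + 1) j ≤ m + 1 := by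
    intro i j hi hj
    rw [Equiv.swap_apply_def]
    split_ifs <;> omega
  have key : ∃ j ≤ m + 1, g * (sweep t (m + 1) j)⁻¹ ∈ D := by
    refine Subgroup.closure_induction_right (p := fun g _ => ∃ j ≤ m + 1,
      g * (sweep t (m + 1) j)⁻¹ ∈ D) ?_ ?_ ?_ hg
    · exact ⟨m + 1, le_rfl, by simp [sweep_self, one_mem]⟩
    · rintro g - _ ⟨i, hi, rfl⟩ ⟨j, hj, hgj⟩
      have hi : i ≤ m := Nat.lt_succ_iff.1 hi
      refine ⟨_, swap_le hi hj, ?_⟩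
      convert mul_mem hgj (ht.sweep_mul_mem hm hi hj) using 1
      group
    · rintro g - _ ⟨i, hi, rfl⟩ ⟨j, hj, hgj⟩
      have hi : i ≤ m := Nat.lt_succ_iff.1 hi
      refine ⟨_, swap_le hi hj, ?_⟩
      convert mul_mem hgj (inv_mem (ht.sweep_mul_mem hm hi (swap_le hi hj))) using 1
      rw [Equiv.swap_apply_self]
      group
  obtain ⟨j, hj, hgj⟩ := key
  rw [hD, ← SetLike.mem_coe, Subgroup.coe_mul_of_right_le_normalizer_left _ _
    (ht.initialSubgroup_le_normalizer hm)] at hgj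
  obtain ⟨a, ha, h, hh, e⟩ := hgj
  exact ⟨a, ha, h, hh, j, hj, by simp only [e]; group⟩

end Combing

/-- The `i`-th generator of the free group on `n + 1` generators, and `1` if `n < i`. -/
def freeGen (n i : ℕ) : FreeGroup (Fin (n + 1)) :=
  if h : i < n + 1 then FreeGroup.of ⟨i, h⟩ else 1

/-- The endomorphism of a free group sending the generator `a` to `1`. -/
def killGen {α : Type*} [DecidableEq α] (a : α) : FreeGroup α →* FreeGroup α :=
  FreeGroup.lift fun b => if b = a then 1 else FreeGroup.of b

/-- Left translation of `FreeGroup α × Bool` by a generator, with the generator `a` replaced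
by the transposition of the two points over `1`. -/
def translationSwap {α : Type*} [DecidableEq α] (a : α) :
    FreeGroup α →* Equiv.Perm (FreeGroup α × Bool) :=
  FreeGroup.lift fun b => if b = a then Equiv.swap (1, false) (1, true)
    else (Equiv.mulLeft (FreeGroup.of b)).prodCongr (Equiv.refl Bool)

theorem translationSwap_fst {α : Type*} [DecidableEq α] (a : α) (u : FreeGroup α)
    (p : FreeGroup α × Bool) : (translationSwap a u p).1 = killGen a u * p.1 := by
  have base : ∀ b p, (translationSwap a (FreeGroup.of b) p).1 =
      killGen a (FreeGroup.of b) * p.1 := by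
    intro b p
    by_cases hb : b = a
    · simp only [translationSwap, killGen, FreeGroup.lift_apply_of, hb, if_true,
        Equiv.swap_apply_def]
      split_ifs <;> simp_all
    · simp [translationSwap, killGen, hb]
  induction u using FreeGroup.induction_on generalizing p with
  | C1 => simp
  | of b => exact base b p
  | inv_of b _ =>
    have := base b ((translationSwap a (FreeGroup.of b))⁻¹ p)
    rw [← Equiv.Perm.mul_apply, mul_inv_cancel, Equiv.Perm.one_apply] at this
    rw [map_inv, map_inv, this, inv_mul_cancel_left]
  | mul u v hu hv => rw [map_mul, Equiv.Perm.mul_apply, hu, hv, map_mul, mul_assoc]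

/-- An element commuting with a generator dies when that generator is killed. -/
theorem killGen_eq_one_of_commute {α : Type*} [DecidableEq α] {a : α} {u : FreeGroup α}
    (h : Commute u (FreeGroup.of a)) : killGen a u = 1 := by
  by_contra hu
  have hswap : translationSwap a (FreeGroup.of a) = Equiv.swap (1, false) (1, true) := by
    simp [translationSwap]
  have h1 := congrArg (fun v => translationSwap a v (1, false)) h.eq
  simp only [map_mul, hswap, Equiv.Perm.mul_apply, Equiv.swap_apply_left] at h1
  have h2 : (translationSwap a u (1, false)).1 ≠ 1 := by
    rwa [translationSwap_fst, mul_one]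
  rw [Equiv.swap_apply_of_ne_of_ne (fun h => h2 (congrArg Prod.fst h))
    (fun h => h2 (congrArg Prod.fst h))] at h1
  simpa using (translationSwap a u).injective h1

/-- The generators `t 0, …, t (n - 1)` act through `ρ` by the inverses of Artin's automorphisms. -/
structure IsInverseArtinFamily {G : Type*} [Group G] (n : ℕ)
    (ρ : G →* MulAut (FreeGroup (Fin (n + 1)))) (t : ℕ → G) : Prop where
  left : ∀ i < n, ρ (t i) (freeGen n i) = freeGen n (i + 1)
  right : ∀ i < n, ρ (t i) (freeGen n (i + 1)) =
    (freeGen n (i + 1))⁻¹ * freeGen n i * freeGen n (i + 1)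
  other : ∀ i < n, ∀ j, j ≠ i → j ≠ i + 1 → ρ (t i) (freeGen n j) = freeGen n j

theorem freeGen_val {n : ℕ} (j : Fin (n + 1)) : freeGen n j = FreeGroup.of j := by
  simp [freeGen, j.is_le]

theorem freeGen_hom_ext {n : ℕ} {M : Type*} [Monoid M] {f g : FreeGroup (Fin (n + 1)) →* M}
    (h : ∀ j, f (freeGen n j) = g (freeGen n j)) : f = g :=
  FreeGroup.ext_hom _ _ fun j => by rw [← freeGen_val, h]

theorem killGen_freeGen {n : ℕ} (m : Fin (n + 1)) (j : ℕ) :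
    killGen m (freeGen n j) = if j = m then 1 else freeGen n j := by
  by_cases h : j < n + 1 <;> simp [freeGen, h, killGen, Fin.ext_iff]

theorem killGen_freeGen_self {n : ℕ} (m : Fin (n + 1)) : killGen m (freeGen n m) = 1 := by
  simp [killGen_freeGen]

theorem freeGen_ne_one {n j : ℕ} (hj : j ≤ n) : freeGen n j ≠ 1 := by
  simp [freeGen, Nat.lt_succ_of_le hj, FreeGroup.of_ne_one]

namespace IsInverseArtinFamily

variable {G : Type*} [Group G] {n : ℕ} {t : ℕ → G} {ρ : G →* MulAut (FreeGroup (Fin (n + 1)))}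

theorem sweep_freeGen_of_lt (hρ : IsInverseArtinFamily n ρ t) {m : ℕ} (hm : m ≤ n) {i : ℕ} :
    ∀ j ≤ m, i < j → ρ (sweep t m j) (freeGen n i) = freeGen n i := by
  refine sweep_induction (fun _ => by simp [sweep_self]) ?_
  intro j hj ih hij
  rw [sweep_of_lt t hj, map_mul, MulAut.mul_apply,
    hρ.other j (by omega) i (by omega) (by omega), ih (by omega)]

theorem sweep_freeGen_self (hρ : IsInverseArtinFamily n ρ t) {m : ℕ} (hm : m ≤ n) :
    ∀ j ≤ m, ρ (sweep t m j) (freeGen n j) = freeGen n m := by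
  refine sweep_induction (by simp [sweep_self]) ?_
  intro j hj ih
  rw [sweep_of_lt t hj, map_mul, MulAut.mul_apply, hρ.left j (by omega), ih]

theorem loop_freeGen_self (hρ : IsInverseArtinFamily n ρ t) {m : ℕ} (hm : m ≤ n) {i : ℕ}
    (hi : i < m) : ρ (loop t m i) (freeGen n m) =
      (freeGen n i * freeGen n m)⁻¹ * freeGen n m * (freeGen n i * freeGen n m) := by
  have h1 := hρ.sweep_freeGen_self hm (i + 1) hi
  have h2 := hρ.sweep_freeGen_of_lt hm (i := i) (i + 1) hi (by omega)
  have h3 : (ρ (sweep t m (i + 1)))⁻¹ (freeGen n m) = freeGen n (i + 1) := by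
    rw [← h1, MulAut.inv_apply_self]
  simp only [loop, map_inv ρ, map_mul, MulAut.mul_apply, h3, hρ.left i (by omega),
    hρ.right i (by omega), map_inv (ρ _), h1, h2]
  group

theorem killGen_loop (hρ : IsInverseArtinFamily n ρ t) {m : Fin (n + 1)} {i : ℕ}
    (hi : i < m) (y : FreeGroup (Fin (n + 1))) : killGen m (ρ (loop t m i) y) = killGen m y := by
  have hm : (m : ℕ) ≤ n := Nat.lt_succ_iff.1 m.2
  have h1 := hρ.sweep_freeGen_self hm (i + 1) hi
  have h2 := hρ.sweep_freeGen_of_lt hm (i := i) (i + 1) hi (by omega)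
  have key : (killGen m).comp (ρ (sweep t m (i + 1) * (t i * t i))).toMonoidHom =
      (killGen m).comp (ρ (sweep t m (i + 1))).toMonoidHom := by
    refine freeGen_hom_ext fun j => ?_
    by_cases hj : j = i
    · subst hj
      simp [hρ.left j (by omega), hρ.right j (by omega), h1, h2,
        killGen_freeGen_self]
    by_cases hj' : j = i + 1
    · subst hj'
      simp [hρ.left i (by omega), hρ.right i (by omega), h1, h2,
        killGen_freeGen_self]
    · simp [hρ.other i (by omega) j hj hj']
  have := DFunLike.congr_fun key (ρ (sweep t m (i + 1))⁻¹ y)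
  simpa [loop, MulAut.mul_apply] using this

theorem killGen_of_mem_loopSubgroup (hρ : IsInverseArtinFamily n ρ t) {m : Fin (n + 1)} {a : G}
    (ha : a ∈ loopSubgroup t m) (y : FreeGroup (Fin (n + 1))) :
    killGen m (ρ a y) = killGen m y := by
  induction ha using Subgroup.closure_induction generalizing y with
  | mem _ h => obtain ⟨i, hi, rfl⟩ := h; exact hρ.killGen_loop hi y
  | one => simp
  | mul a b _ _ ha hb => rw [map_mul, MulAut.mul_apply, ha, hb]
  | inv a _ ha => rw [← ha, map_inv, MulAut.apply_inv_self]

theorem gen_killGen (hρ : IsInverseArtinFamily n ρ t) {m : Fin (n + 1)} {i : ℕ}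
    (hi : i + 1 < m) (y : FreeGroup (Fin (n + 1))) :
    killGen m (ρ (t i) y) = ρ (t i) (killGen m y) := by
  have hm : (m : ℕ) ≤ n := Nat.lt_succ_iff.1 m.2
  have key : (killGen m).comp (ρ (t i)).toMonoidHom = (ρ (t i)).toMonoidHom.comp (killGen m) := by
    refine freeGen_hom_ext fun j => ?_
    have e1 : i ≠ m := by omega
    have e2 : i + 1 ≠ m := by omega
    by_cases hj : j = i
    · subst hj
      simp [killGen_freeGen, e1, e2, hρ.left j (by omega)]
    by_cases hj' : j = i + 1
    · subst hj'
      simp [killGen_freeGen, e1, e2, hρ.right i (by omega)]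
    by_cases hjm : j = m
    · have := hρ.other i (by omega) j hj hj'
      subst hjm
      simp [this, killGen_freeGen_self]
    · simp [hρ.other i (by omega) j hj hj', killGen_freeGen, hjm]
  exact DFunLike.congr_fun key y

theorem killGen_of_mem_initialSubgroup (hρ : IsInverseArtinFamily n ρ t) {k : ℕ} (hk : k + 1 ≤ n)
    {h : G} (hh : h ∈ initialSubgroup t k) :
    (∀ y, killGen (⟨k + 1, Nat.lt_succ_of_le hk⟩ : Fin (n + 1)) (ρ h y) =
      ρ h (killGen (⟨k + 1, Nat.lt_succ_of_le hk⟩ : Fin (n + 1)) y)) ∧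
    ρ h (freeGen n (k + 1)) = freeGen n (k + 1) := by
  induction hh using Subgroup.closure_induction with
  | mem _ h =>
    obtain ⟨i, hi, rfl⟩ := h
    have hi : i < k := hi
    exact ⟨hρ.gen_killGen (Nat.succ_lt_succ hi),
      hρ.other i (by omega) _ (by omega) (by omega)⟩
  | one => simp
  | mul a b _ _ ha hb =>
    simp [MulAut.mul_apply, ha.1, ha.2, hb.1, hb.2]
  | inv a _ ha =>
    refine ⟨fun y => (ρ a).injective ?_, (ρ a).injective ?_⟩
    · rw [← ha.1, map_inv, MulAut.apply_inv_self, MulAut.apply_inv_self]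
    · rw [map_inv, MulAut.apply_inv_self, ha.2]

/-- The loops of the strand `m` around the strands `0, …, m - 1` as images of free generators. -/
noncomputable def loopHom (t : ℕ → G) (m : Fin (n + 1)) : FreeGroup (Fin (n + 1)) →* G :=
  FreeGroup.lift fun i => if i < m then loop t m i else 1

/-- The retraction onto the free group on the generators before `m`. -/
def truncate (m : Fin (n + 1)) : FreeGroup (Fin (n + 1)) →* FreeGroup (Fin (n + 1)) :=
  FreeGroup.lift fun i => if i < m then FreeGroup.of i else 1

theorem loopHom_truncate (t : ℕ → G) (m : Fin (n + 1)) (w : FreeGroup (Fin (n + 1))) :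
    loopHom t m (truncate m w) = loopHom t m w := by
  have : (loopHom t m).comp (truncate m) = loopHom t m := by
    refine FreeGroup.ext_hom _ _ fun i => ?_
    by_cases hi : i < m <;> simp [loopHom, truncate, hi]
  exact DFunLike.congr_fun this w

theorem loopHom_mem (t : ℕ → G) (m : Fin (n + 1)) (w : FreeGroup (Fin (n + 1))) :
    loopHom t m w ∈ loopSubgroup t m := by
  refine FreeGroup.range_lift_le (s := loopSubgroup t m) ?_ ⟨w, rfl⟩
  rintro _ ⟨i, rfl⟩
  by_cases hi : i < m
  · simpa [hi] using loop_mem t hi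
  · simp [hi, one_mem]

theorem exists_loopHom_eq {m : Fin (n + 1)} {a : G} (ha : a ∈ loopSubgroup t m) :
    ∃ w, loopHom t m w = a := by
  suffices h : loopSubgroup t m ≤ (loopHom t m).range from h ha
  refine (Subgroup.closure_le _).2 ?_
  rintro _ ⟨i, hi, rfl⟩
  have hi : i < (m : ℕ) := hi
  refine ⟨FreeGroup.of ⟨i, hi.trans m.2⟩, ?_⟩
  rw [loopHom, FreeGroup.lift_apply_of, if_pos (Fin.lt_def.2 hi)]

theorem exists_conj_loopHom (hρ : IsInverseArtinFamily n ρ t) (m : Fin (n + 1))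
    (w : FreeGroup (Fin (n + 1))) :
    ∃ u, ρ (loopHom t m w) (freeGen n m) = u⁻¹ * freeGen n m * u ∧
      killGen m u = truncate m w := by
  have hm : (m : ℕ) ≤ n := Nat.lt_succ_iff.1 m.2
  induction w using FreeGroup.induction_on with
  | C1 => exact ⟨1, by simp⟩
  | of i =>
    by_cases hi : i < m
    · refine ⟨freeGen n i * freeGen n m, ?_, ?_⟩
      · simpa [loopHom, hi] using hρ.loop_freeGen_self hm hi
      · rw [map_mul, killGen_freeGen, killGen_freeGen_self, if_neg (Fin.val_ne_of_ne hi.ne),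
          mul_one, freeGen_val, truncate, FreeGroup.lift_apply_of, if_pos hi]
    · exact ⟨1, by simp [loopHom, hi], by simp [truncate, hi]⟩
  | inv_of i ih =>
    obtain ⟨u, hu, hku⟩ := ih
    set a := loopHom t m (FreeGroup.of i) with ha
    refine ⟨ρ a⁻¹ u⁻¹, (ρ a).injective ?_, ?_⟩
    · simp only [map_inv, map_mul, MulAut.apply_inv_self, ← ha, hu]
      group
    · rw [hρ.killGen_of_mem_loopSubgroup (inv_mem (loopHom_mem t m _)), map_inv, map_inv, hku]
  | mul w w' ih ih' =>
    obtain ⟨u, hu, hku⟩ := ih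
    obtain ⟨u', hu', hku'⟩ := ih'
    refine ⟨u * ρ (loopHom t m w) u', ?_, ?_⟩
    · simp only [map_mul, MulAut.mul_apply, hu', map_inv, hu]
      group
    · rw [map_mul, hρ.killGen_of_mem_loopSubgroup (loopHom_mem t m _), map_mul, hku, hku']

theorem eq_one_of_mem_loopSubgroup (hρ : IsInverseArtinFamily n ρ t) {m : Fin (n + 1)} {a : G}
    (ha : a ∈ loopSubgroup t m) (h1 : ρ a = 1) : a = 1 := by
  obtain ⟨w, rfl⟩ := exists_loopHom_eq ha
  obtain ⟨u, hu, hku⟩ := hρ.exists_conj_loopHom m w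
  rw [h1, MulAut.one_apply, freeGen_val, mul_assoc, eq_inv_mul_iff_mul_eq] at hu
  rw [← loopHom_truncate, ← hku, killGen_eq_one_of_commute hu, map_one]

theorem eq_one_of_mem_initialSubgroup (hρ : IsInverseArtinFamily n ρ t) (ht : IsBraidFamily n t)
    {k : ℕ} (hk : k ≤ n) {g : G} (hg : g ∈ initialSubgroup t k) (h1 : ρ g = 1) : g = 1 := by
  induction k generalizing g with
  | zero => simpa [initialSubgroup] using hg
  | succ k ih =>
    obtain ⟨a, ha, h, hh, j, hj, rfl⟩ := ht.exists_combing hk hg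
    let m : Fin (n + 1) := ⟨k + 1, Nat.lt_succ_of_le hk⟩
    obtain ⟨hcomm, hfix⟩ := hρ.killGen_of_mem_initialSubgroup hk hh
    have hkill : ∀ y, killGen m y = ρ h (killGen m (ρ (sweep t (k + 1) j) y)) := fun y => by
      rw [← hcomm, ← hρ.killGen_of_mem_loopSubgroup (m := m) ha (ρ h _), ← MulAut.mul_apply,
        ← MulAut.mul_apply, ← map_mul, ← map_mul, h1, MulAut.one_apply]
    obtain rfl : j = k + 1 := by
      by_contra hne
      have := hkill (freeGen n j)
      rw [hρ.sweep_freeGen_self hk j hj, killGen_freeGen_self m, map_one, killGen_freeGen,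
        if_neg hne] at this
      exact freeGen_ne_one (by omega) this
    have hh1 : ρ h = 1 := by
      have : (ρ h).toMonoidHom = MonoidHom.id _ := by
        refine freeGen_hom_ext fun j => ?_
        by_cases hj : j = k + 1
        · subst hj; exact hfix
        · have := hkill (freeGen n j)
          rw [sweep_self, map_one, MulAut.one_apply, killGen_freeGen, if_neg hj] at this
          exact this.symm
      exact MulEquiv.ext fun y => DFunLike.congr_fun this y
    obtain rfl := ih (by omega) hh hh1
    rw [sweep_self, mul_one, mul_one] at h1 ⊢
    exact hρ.eq_one_of_mem_loopSubgroup (m := m) ha h1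

end IsInverseArtinFamily

/-- The Artin automorphism `a ↦ a b a⁻¹`, `b ↦ a` of a free group. -/
def artinAut {α : Type*} [DecidableEq α] (a b : α) (hab : a ≠ b) : MulAut (FreeGroup α) :=
  MonoidHom.toMulEquiv
    (FreeGroup.lift fun c => if c = a then FreeGroup.of a * FreeGroup.of b * (FreeGroup.of a)⁻¹
      else if c = b then FreeGroup.of a else FreeGroup.of c)
    (FreeGroup.lift fun c => if c = a then FreeGroup.of b
      else if c = b then (FreeGroup.of b)⁻¹ * FreeGroup.of a * FreeGroup.of b else FreeGroup.of c)
    (FreeGroup.ext_hom _ _ fun c => by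
      by_cases ha : c = a
      · simp [ha, hab.symm, mul_assoc]
      · by_cases hb : c = b <;> simp [ha, hb, hab.symm])
    (FreeGroup.ext_hom _ _ fun c => by
      by_cases ha : c = a
      · simp [ha, hab.symm]
      · by_cases hb : c = b <;> simp [ha, hb, hab.symm, mul_assoc])

section ArtinAut

variable {α : Type*}

theorem mulAut_freeGroup_ext {f g : MulAut (FreeGroup α)}
    (h : ∀ c, f (FreeGroup.of c) = g (FreeGroup.of c)) : f = g :=
  MulEquiv.ext fun y => DFunLike.congr_fun
    (FreeGroup.ext_hom f.toMonoidHom g.toMonoidHom h) y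

variable [DecidableEq α]

theorem artinAut_of (a b : α) (hab : a ≠ b) (c : α) : artinAut a b hab (FreeGroup.of c) =
    if c = a then FreeGroup.of a * FreeGroup.of b * (FreeGroup.of a)⁻¹
      else if c = b then FreeGroup.of a else FreeGroup.of c :=
  FreeGroup.lift_apply_of

theorem artinAut_comm {a b c d : α} (hab : a ≠ b) (hcd : c ≠ d) (hac : a ≠ c) (had : a ≠ d)
    (hbc : b ≠ c) (hbd : b ≠ d) :
    artinAut a b hab * artinAut c d hcd = artinAut c d hcd * artinAut a b hab := by
  refine mulAut_freeGroup_ext fun e => ?_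
  simp only [MulAut.mul_apply, artinAut_of]
  split_ifs <;> simp_all [artinAut_of, Ne.symm hac, Ne.symm had, Ne.symm hbc, Ne.symm hbd]

theorem artinAut_braid {a b c : α} (hab : a ≠ b) (hbc : b ≠ c) (hac : a ≠ c) :
    artinAut a b hab * artinAut b c hbc * artinAut a b hab =
      artinAut b c hbc * artinAut a b hab * artinAut b c hbc := by
  refine mulAut_freeGroup_ext fun e => ?_
  by_cases ha : e = a
  · simp [MulAut.mul_apply, artinAut_of, ha, hab.symm, hac, hac.symm, hab, hbc.symm, mul_assoc]
  by_cases hb : e = b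
  · simp [MulAut.mul_apply, artinAut_of, hb, hab.symm, hac, hac.symm, hab, hbc.symm, mul_assoc]
  by_cases hc : e = c
  · simp [MulAut.mul_apply, artinAut_of, hc, hac.symm, hab.symm, hbc.symm, hac, hab]
  · simp [MulAut.mul_apply, artinAut_of, ha, hb, hc]

end ArtinAut

theorem braidGen_comm (n : ℕ) {i j : Fin n} (hij : (i : ℕ) + 2 ≤ j) :
    braidGen n i * braidGen n j = braidGen n j * braidGen n i :=
  PresentedGroup.mk_eq_mk_of_mul_inv_mem (rels := braidRels n) (Or.inl ⟨i, j, hij, rfl⟩)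

theorem braidGen_braid (n : ℕ) {i j : Fin n} (hij : (i : ℕ) + 1 = j) :
    braidGen n i * braidGen n j * braidGen n i = braidGen n j * braidGen n i * braidGen n j :=
  PresentedGroup.mk_eq_mk_of_mul_inv_mem (rels := braidRels n) (Or.inr ⟨i, j, hij, rfl⟩)

theorem closure_range_braidGen (n : ℕ) : Subgroup.closure (Set.range (braidGen n)) = ⊤ :=
  PresentedGroup.closure_range_of (braidRels n)

theorem exists_isArtinAction (n : ℕ) :
    ∃ ρ : BraidGroup n →* MulAut (FreeGroup (Fin (n + 1))), IsArtinAction n ρ := by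
  let f : Fin n → MulAut (FreeGroup (Fin (n + 1))) := fun i =>
    artinAut i.castSucc i.succ (Fin.castSucc_lt_succ).ne
  have hf : ∀ r ∈ braidRels n, FreeGroup.lift f r = 1 := by
    rintro r (⟨i, j, hij, rfl⟩ | ⟨i, j, hij, rfl⟩)
    · simp only [map_mul, map_inv, FreeGroup.lift_apply_of, mul_inv_eq_one]
      apply artinAut_comm <;> simp only [ne_eq, Fin.ext_iff, Fin.val_castSucc, Fin.val_succ] <;>
        omega
    · simp only [map_mul, map_inv, FreeGroup.lift_apply_of, mul_inv_eq_one]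
      have h : j.castSucc = i.succ := Fin.ext hij.symm
      simp only [f, h]
      apply artinAut_braid
      simp only [ne_eq, Fin.ext_iff, Fin.val_castSucc, Fin.val_succ]
      omega
  obtain ⟨ρ, h⟩ : ∃ ρ : BraidGroup n →* MulAut (FreeGroup (Fin (n + 1))),
      ∀ i, ρ (braidGen n i) = f i :=
    ⟨PresentedGroup.toGroup hf, fun _ => PresentedGroup.toGroup.of hf⟩
  refine ⟨ρ, fun i => ?_⟩
  rw [h]
  refine ⟨?_, ?_, fun j hj hj' => ?_⟩
  · simp [f, artinAut_of]
  · simp [f, artinAut_of, (Fin.castSucc_lt_succ (i := i)).ne']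
  · simp [f, artinAut_of, hj, hj']

theorem IsArtinAction.unique {n : ℕ} {ρ ρ' : BraidGroup n →* MulAut (FreeGroup (Fin (n + 1)))}
    (h : IsArtinAction n ρ) (h' : IsArtinAction n ρ') : ρ' = ρ := by
  refine MonoidHom.eq_of_eqOn_dense (closure_range_braidGen n) ?_
  rintro _ ⟨i, rfl⟩
  refine mulAut_freeGroup_ext fun j => ?_
  obtain ⟨h1, h2, h3⟩ := h i
  obtain ⟨h1', h2', h3'⟩ := h' i
  by_cases hj : j = i.castSucc
  · rw [hj, h1, h1']
  by_cases hj' : j = i.succ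
  · rw [hj', h2, h2']
  · rw [h3 j hj hj', h3' j hj hj']

/-- The inverses of the standard generators, extended by `1`. -/
noncomputable def braidGenInv (n i : ℕ) : BraidGroup n :=
  if h : i < n then (braidGen n ⟨i, h⟩)⁻¹ else 1

theorem isBraidFamily_braidGenInv (n : ℕ) : IsBraidFamily n (braidGenInv n) where
  comm i j hij hj := by
    have hi : i < n := by omega
    simp only [braidGenInv, hi, hj, dif_pos, ← mul_inv_rev]
    rw [braidGen_comm n (i := ⟨i, hi⟩) (j := ⟨j, hj⟩) hij]
  braid i hi := by
    have hi' : i < n := by omega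
    simp only [braidGenInv, hi, hi', dif_pos, ← mul_inv_rev]
    rw [← mul_assoc, ← mul_assoc, braidGen_braid n (i := ⟨i, hi'⟩) (j := ⟨i + 1, hi⟩) rfl]

theorem initialSubgroup_braidGenInv (n : ℕ) : initialSubgroup (braidGenInv n) n = ⊤ := by
  rw [eq_top_iff, ← closure_range_braidGen, Subgroup.closure_le]
  rintro _ ⟨i, rfl⟩
  rw [SetLike.mem_coe, ← inv_mem_iff]
  simpa [braidGenInv] using gen_mem (braidGenInv n) i.2

theorem IsArtinAction.isInverseArtinFamily {n : ℕ}
    {ρ : BraidGroup n →* MulAut (FreeGroup (Fin (n + 1)))} (h : IsArtinAction n ρ) :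
    IsInverseArtinFamily n ρ (braidGenInv n) := by
  have left : ∀ i (hi : i < n), ρ (braidGen n ⟨i, hi⟩) (freeGen n i) =
      freeGen n i * freeGen n (i + 1) * (freeGen n i)⁻¹ := fun i hi => by
    have := (h ⟨i, hi⟩).1
    rwa [← freeGen_val, ← freeGen_val] at this
  have right : ∀ i (hi : i < n), ρ (braidGen n ⟨i, hi⟩) (freeGen n (i + 1)) = freeGen n i :=
    fun i hi => by
      have := (h ⟨i, hi⟩).2.1
      rwa [← freeGen_val, ← freeGen_val] at this
  refine ⟨fun i hi => ?_, fun i hi => ?_, fun i hi j hj hj' => ?_⟩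
  all_goals
    simp only [braidGenInv, hi, dif_pos, map_inv]
    refine (ρ (braidGen n ⟨i, hi⟩)).injective ?_
    rw [MulAut.apply_inv_self]
  · rw [right]
  · simp only [map_mul, map_inv, right, left]
    group
  · by_cases hjn : j < n + 1
    · have := (h ⟨i, hi⟩).2.2 ⟨j, hjn⟩ (by simpa [Fin.ext_iff] using hj)
        (by simpa [Fin.ext_iff] using hj')
      rw [← freeGen_val] at this
      exact this.symm
    · simp [freeGen, hjn]

theorem IsArtinAction.injective {n : ℕ} {ρ : BraidGroup n →* MulAut (FreeGroup (Fin (n + 1)))}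
    (h : IsArtinAction n ρ) : Function.Injective ρ :=
  (injective_iff_map_eq_one ρ).2 fun g hg =>
    h.isInverseArtinFamily.eq_one_of_mem_initialSubgroup (isBraidFamily_braidGenInv n) le_rfl
      (by rw [initialSubgroup_braidGenInv]; exact Subgroup.mem_top g) hg

/-- **Artin.** There is a unique homomorphism `ρ` from the braid group
`B_{n+1}` to the automorphism group of the free group `F_{n+1}` satisfying Artin's
formulas, and `ρ` is injective (the action is faithful). -/
theorem stmt_7 (n : ℕ) (hn : 1 ≤ n) :
    ∃ ρ : BraidGroup n →* MulAut (FreeGroup (Fin (n + 1))),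
      IsArtinAction n ρ ∧
      (∀ ρ' : BraidGroup n →* MulAut (FreeGroup (Fin (n + 1))),
        IsArtinAction n ρ' → ρ' = ρ) ∧
      Function.Injective ρ := by
  obtain ⟨ρ, hρ⟩ := exists_isArtinAction n
  exact ⟨ρ, hρ, fun _ hρ' => hρ.unique hρ', hρ.injective⟩
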